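/- Let N ≥ 1, let h : Fin N → ℝ satisfy 0 < h i for all i, and suppose there is an index m such that h i < h m for all i ≠ m. Let λ : Fin N → ℝ satisfy 0 < λ i for all i. Then, as C → ∞ (over real C), the sampling probability ρ_i(C) = λ i * (h i)^C / (∑ j, λ j * (h j)^C) tends to 1 when i = m and tends to 0 when i ≠ m. -/

import Mathlib

open Filter Finset

/-- Normalized exponential weights concentrate on the strict maximizer of the base. -/
theorem tendsto_weighted_rpow_div_sum {ι : Type*} [Fintype ι] [DecidableEq ι] {h w : ι → ℝ}
    (hpos : ∀ i, 0 < h i) {m : ι} (hw : w m ≠ 0) (hmax : ∀ i, i ≠ m → h i < h m) (i : ι) :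
    Tendsto (fun C : ℝ => w i * h i ^ C / ∑ j, w j * h j ^ C) atTop
      (nhds (if i = m then 1 else 0)) := by
  have ratio (j : ι) : Tendsto (fun C : ℝ => w j * (h j / h m) ^ C) atTop
      (nhds (if j = m then w m else 0)) := by
    by_cases hj : j = m
    · subst hj
      simp [div_self (hpos j).ne']
    · have hlt : h j / h m < 1 := (div_lt_one (hpos m)).2 (hmax j hj)
      have hgt : -1 < h j / h m := by linarith [div_pos (hpos j) (hpos m)]
      simpa [hj] using (tendsto_rpow_atTop_of_base_lt_one _ hgt hlt).const_mul (w j)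
  have sum_ratio : Tendsto (fun C : ℝ => ∑ j, w j * (h j / h m) ^ C) atTop (nhds (w m)) := by
    simpa using tendsto_finsetSum univ fun j _ => ratio j
  have quotient := (ratio i).div sum_ratio hw
  have limit_eq : (if i = m then w m else 0) / w m = if i = m then (1 : ℝ) else 0 := by
    split_ifs <;> simp [hw]
  rw [limit_eq] at quotient
  refine quotient.congr fun C => ?_
  have hC : h m ^ C ≠ 0 := (Real.rpow_pos_of_pos (hpos m) C).ne'
  simp only [Pi.div_apply, Real.div_rpow (hpos _).le (hpos m).le, ← mul_div_assoc,
    ← Finset.sum_div]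
  exact div_div_div_cancel_right₀ hC _ _

/-- As the real exponent `C → ∞`, the channel-aware sampling probability
`ρ_i(C) = λ i * (h i)^C / (∑ j, λ j * (h j)^C)` tends to `1` for the client `m` with the
strictly largest channel and to `0` for every other client. -/
theorem caafl_rho_limit (N : ℕ) (hN : 1 ≤ N) (h lam : Fin N → ℝ)
    (hpos : ∀ i, 0 < h i) (lampos : ∀ i, 0 < lam i)
    (m : Fin N) (hmax : ∀ i, i ≠ m → h i < h m) :
    Tendsto (fun C : ℝ => lam m * h m ^ C / ∑ j, lam j * h j ^ C) atTop (nhds 1) ∧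
    ∀ i, i ≠ m →
      Tendsto (fun C : ℝ => lam i * h i ^ C / ∑ j, lam j * h j ^ C) atTop (nhds 0) := by
  have key := tendsto_weighted_rpow_div_sum hpos (lampos m).ne' hmax
  exact ⟨by simpa using key m, fun i hi => by simpa [hi] using key i⟩
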